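/- For independent standard Gaussian random variables Y, Z and any n, m ≥ 0, E[√(Y²+Z²) H_{2n}(Y) H_{2m}(Z)] = √(π/2) · ((2n)!(2m)!/(n! m! 2^{n+m})) · Σ_{j=0}^{n+m} (−1)^{n+m} (−1)^j C(n+m, j) ((2j+1)!/(j!)²) (1/4)^j. -/

import Mathlib

open Real Polynomial MeasureTheory ProbabilityTheory

/-- Half-line Gaussian moment. -/
noncomputable def gmom (j : ℕ) : ℝ := ∫ r in Set.Ioi (0:ℝ), r ^ j * rexp (-r ^ 2 / 2)

lemma dfact_eq (k : ℕ) : (((2 * k - 1).doubleFactorial : ℕ) : ℝ)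
    = (Nat.factorial (2 * k) : ℝ) / (2 ^ k * Nat.factorial k) := by
  rcases k with _ | k
  · simp
  · rw [eq_div_iff (by positivity)]
    have h1 := Nat.factorial_eq_mul_doubleFactorial (2 * k + 1)
    have h2 := Nat.doubleFactorial_two_mul (k + 1)
    have e : 2 * (k + 1) - 1 = 2 * k + 1 := by omega
    have e' : 2 * k + 1 + 1 = 2 * (k + 1) := by ring
    rw [e'] at h1
    rw [e, h1, h2]
    push_cast
    ring

lemma gmom_gamma (j : ℕ) : gmom j =
    (1 / 2 : ℝ) ^ (-((j:ℝ) + 1) / 2) * (1 / 2) * Gamma (((j:ℝ) + 1) / 2) := by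
  rw [← integral_rpow_mul_exp_neg_mul_rpow (p := 2) (q := j) (b := 1 / 2) (by norm_num)
    (by have : (0:ℝ) ≤ j := by positivity
        linarith) (by norm_num)]
  unfold gmom
  congr 1
  ext r
  rw [Real.rpow_natCast, Real.rpow_two]
  congr 2
  ring

lemma gmom_even (k : ℕ) : gmom (2 * k) =
    √(π / 2) * ((Nat.factorial (2 * k) : ℝ) / (2 ^ k * Nat.factorial k)) := by
  rw [gmom_gamma, ← dfact_eq]
  have e : (((2 * k : ℕ) : ℝ) + 1) / 2 = k + 1 / 2 := by push_cast; ring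
  rw [neg_div, e, Real.Gamma_nat_add_half, one_div, Real.inv_rpow (by norm_num),
    Real.rpow_neg (by norm_num), inv_inv, Real.rpow_add (by norm_num), Real.rpow_natCast,
    show (2:ℝ) ^ (2⁻¹:ℝ) = √2 by rw [Real.sqrt_eq_rpow, one_div], Real.sqrt_div' _ (by norm_num)]
  have h2 : √2 * √2 = (2:ℝ) := Real.mul_self_sqrt (by norm_num)
  have h3 : √2 ≠ (0:ℝ) := by positivity
  field_simp
  linear_combination h2

lemma gmom_odd (k : ℕ) : gmom (2 * k + 1) = 2 ^ k * Nat.factorial k := by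
  rw [gmom_gamma]
  have e : (((2 * k + 1 : ℕ) : ℝ) + 1) / 2 = k + 1 := by push_cast; ring
  rw [neg_div, e, Real.Gamma_nat_eq_factorial, one_div, Real.inv_rpow (by norm_num),
    Real.rpow_neg (by norm_num), inv_inv, Real.rpow_add (by norm_num), Real.rpow_natCast,
    Real.rpow_one]
  ring

lemma full_even (a : ℕ) : ∫ x : ℝ, x ^ (2 * a) * rexp (-x ^ 2 / 2) = 2 * gmom (2 * a) := by
  unfold gmom
  rw [← integral_comp_abs (f := fun x => x ^ (2 * a) * rexp (-x ^ 2 / 2))]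
  congr 1
  ext x
  simp [pow_mul]

lemma polar_int (s a b : ℕ) :
    ∫ p : ℝ × ℝ, √(p.1 ^ 2 + p.2 ^ 2) ^ s * (p.1 ^ (2 * a) * p.2 ^ (2 * b)) *
      rexp (-(p.1 ^ 2 + p.2 ^ 2) / 2)
    = gmom (2 * (a + b) + 1 + s) *
      ∫ t in Set.Ioo (-π) π, cos t ^ (2 * a) * sin t ^ (2 * b) := by
  rw [← integral_comp_polarCoord_symm]
  unfold gmom
  rw [← setIntegral_prod_mul]
  have ht : MeasurableSet (polarCoord.target) := polarCoord.open_target.measurableSet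
  have : polarCoord.target = Set.Ioi (0 : ℝ) ×ˢ Set.Ioo (-π) π := rfl
  rw [← this]
  refine setIntegral_congr_fun ht ?_
  rintro ⟨r, t⟩ hrt
  have hr : 0 < r := hrt.1
  have h : (r * cos t) ^ 2 + (r * sin t) ^ 2 = r ^ 2 := by
    linear_combination r ^ 2 * Real.sin_sq_add_cos_sq t
  simp only [polarCoord_symm_apply, smul_eq_mul, h, Real.sqrt_sq hr.le]
  ring

lemma main_int (a b : ℕ) :
    ∫ p : ℝ × ℝ, √(p.1 ^ 2 + p.2 ^ 2) * (p.1 ^ (2 * a) * p.2 ^ (2 * b)) *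
      rexp (-(p.1 ^ 2 + p.2 ^ 2) / 2)
    = 2 * π * √(π / 2) * ((Nat.factorial (2 * a) : ℝ) / (2 ^ a * Nat.factorial a)) *
       ((Nat.factorial (2 * b) : ℝ) / (2 ^ b * Nat.factorial b)) *
       ((Nat.factorial (2 * (a + b) + 1) : ℝ) / ((Nat.factorial (a + b) : ℝ) ^ 2)
        * (1 / 4) ^ (a + b)) := by
  have h1 := polar_int 1 a b
  have h0 := polar_int 0 a b
  have h00 : ∫ p : ℝ × ℝ, √(p.1 ^ 2 + p.2 ^ 2) ^ 0 * (p.1 ^ (2 * a) * p.2 ^ (2 * b)) *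
      rexp (-(p.1 ^ 2 + p.2 ^ 2) / 2) = (2 * gmom (2 * a)) * (2 * gmom (2 * b)) := by
    rw [← full_even, ← full_even, ← integral_prod_mul]
    congr 1
    ext p
    rw [show -(p.1 ^ 2 + p.2 ^ 2) / 2 = -p.1 ^ 2 / 2 + -p.2 ^ 2 / 2 by ring, Real.exp_add]
    ring
  rw [h00] at h0
  simp only [pow_one] at h1
  rw [h1]
  rw [add_zero, gmom_odd, gmom_even, gmom_even] at h0
  rw [show 2 * (a + b) + 1 + 1 = 2 * (a + b + 1) by ring, gmom_even,
    show 2 * (a + b + 1) = 2 * (a + b) + 1 + 1 by ring, Nat.factorial_succ (2 * (a + b) + 1),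
    Nat.factorial_succ (a + b)]
  set T := ∫ t in Set.Ioo (-π) π, cos t ^ (2 * a) * sin t ^ (2 * b)
  have hT : T = 2 * π * ((Nat.factorial (2 * a) : ℝ) / (2 ^ a * Nat.factorial a)) *
       ((Nat.factorial (2 * b) : ℝ) / (2 ^ b * Nat.factorial b)) /
       (2 ^ (a + b) * Nat.factorial (a + b)) := by
    rw [eq_div_iff (by positivity), mul_comm, ← h0]
    have h2 : √(π / 2) * √(π / 2) = π / 2 := Real.mul_self_sqrt (by positivity)
    linear_combination (4 * ((Nat.factorial (2 * a) : ℝ) / (2 ^ a * Nat.factorial a)) *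
       ((Nat.factorial (2 * b) : ℝ) / (2 ^ b * Nat.factorial b))) * h2
  rw [hT]
  have h4 : (1 / 4 : ℝ) ^ (a + b) = 1 / (2 ^ (a + b) * 2 ^ (a + b)) := by
    rw [← mul_pow, one_div_pow]; norm_num
  rw [h4]
  generalize hA : ((Nat.factorial (2 * a) : ℝ) / (2 ^ a * Nat.factorial a)) = A
  generalize hB : ((Nat.factorial (2 * b) : ℝ) / (2 ^ b * Nat.factorial b)) = B
  push_cast
  rw [pow_succ]
  field_simp
  ring

lemma main_integrable (a b : ℕ) :
    Integrable (fun p : ℝ × ℝ => √(p.1 ^ 2 + p.2 ^ 2) * (p.1 ^ (2 * a) * p.2 ^ (2 * b)) *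
      rexp (-(p.1 ^ 2 + p.2 ^ 2) / 2)) := by
  apply Integrable.of_integral_ne_zero
  rw [main_int]
  positivity

lemma sum_even (f : ℕ → ℝ) (hf : ∀ k, f (2 * k + 1) = 0) (n : ℕ) :
    ∑ i ∈ Finset.range (2 * n + 1), f i = ∑ a ∈ Finset.range (n + 1), f (2 * a) := by
  induction n with
  | zero => simp
  | succ n ih =>
    rw [Finset.sum_range_succ _ (n + 1), ← ih, show 2 * (n + 1) + 1 = 2 * n + 1 + 1 + 1 by ring,
      Finset.sum_range_succ, Finset.sum_range_succ, hf]
    simp [mul_add]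

lemma hermite_even (n : ℕ) (x : ℝ) : (aeval x (hermite (2 * n)) : ℝ) =
    ∑ a ∈ Finset.range (n + 1), ((-1) ^ n * (-1) ^ a * (Nat.factorial (2 * n) : ℝ) /
      (Nat.factorial n * 2 ^ n) * (n.choose a) *
      (2 ^ a * Nat.factorial a / Nat.factorial (2 * a))) * x ^ (2 * a) := by
  rw [aeval_eq_sum_range' (n := 2 * n + 1) (by simp [natDegree_hermite]), sum_even]
  · refine Finset.sum_congr rfl fun a ha => ?_
    obtain ⟨c, rfl⟩ := Nat.exists_eq_add_of_le' (Nat.lt_succ_iff.mp (Finset.mem_range.mp ha))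
    rw [show 2 * (c + a) = 2 * c + 2 * a by ring, coeff_hermite_explicit, zsmul_eq_mul]
    congr 1
    push_cast
    rw [dfact_eq, ← Nat.choose_symm_add, ← Nat.choose_symm_add, Nat.cast_add_choose,
      Nat.cast_add_choose, pow_add, pow_add]
    have : ((-1:ℝ) ^ a) * (-1) ^ a = 1 := by rw [← mul_pow]; simp
    field_simp
    linear_combination -this
  · intro k
    rw [coeff_hermite_of_odd_add]
    · simp
    · exact ⟨n + k, by ring⟩

lemma vander (n m : ℕ) (h : ℕ → ℝ) :
    ∑ a ∈ Finset.range (n + 1), ∑ b ∈ Finset.range (m + 1),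
      (n.choose a : ℝ) * (m.choose b) * h (a + b)
    = ∑ j ∈ Finset.range (n + m + 1), ((n + m).choose j : ℝ) * h j := by
  let L : ℝ[X] →ₗ[ℝ] ℝ := (Polynomial.basisMonomials ℝ).constr ℝ h
  have hL : ∀ k, L (X ^ k) = h k := by
    intro k
    have := (Polynomial.basisMonomials ℝ).constr_basis ℝ h k
    simpa [L, Polynomial.coe_basisMonomials, Polynomial.monomial_one_right_eq_X_pow] using this
  have hp : ∀ N : ℕ, (X + 1 : ℝ[X]) ^ N = ∑ j ∈ Finset.range (N + 1), (N.choose j : ℝ) • X ^ j := by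
    intro N
    rw [add_pow]
    refine Finset.sum_congr rfl fun j _ => ?_
    rw [one_pow, mul_one, mul_comm, Polynomial.smul_eq_C_mul]
    simp
  have key : L ((X + 1) ^ (n + m)) = L ((X + 1) ^ n * (X + 1) ^ m) := by rw [pow_add]
  rw [hp, hp, hp, Finset.sum_mul_sum] at key
  simp only [map_sum, map_smul, hL, smul_mul_smul_comm, ← pow_add, smul_eq_mul] at key
  exact key.symm

lemma gauss_int (f : ℝ × ℝ → ℝ) :
    ∫ p, f p ∂((gaussianReal 0 1).prod (gaussianReal 0 1)) =
    (2 * π)⁻¹ * ∫ p : ℝ × ℝ, f p * rexp (-(p.1 ^ 2 + p.2 ^ 2) / 2) := by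
  rw [gaussianReal_of_var_ne_zero _ one_ne_zero,
    prod_withDensity (measurable_gaussianPDF _ _) (measurable_gaussianPDF _ _),
    integral_withDensity_eq_integral_toReal_smul
      (f := fun z : ℝ × ℝ => gaussianPDF 0 1 z.1 * gaussianPDF 0 1 z.2)
      (((measurable_gaussianPDF _ _).comp measurable_fst).mul
        ((measurable_gaussianPDF _ _).comp measurable_snd))
      (Filter.Eventually.of_forall fun p =>
        ENNReal.mul_lt_top gaussianPDF_lt_top gaussianPDF_lt_top),
    ← integral_const_mul]
  refine integral_congr_ae (Filter.Eventually.of_forall fun p => ?_)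
  have h2 : (√(2 * π))⁻¹ * (√(2 * π))⁻¹ = (2 * π)⁻¹ := by
    rw [← mul_inv, Real.mul_self_sqrt (by positivity)]
  simp only [ENNReal.toReal_mul, toReal_gaussianPDF, gaussianPDFReal, smul_eq_mul, NNReal.coe_one,
    mul_one, sub_zero]
  rw [show -(p.1 ^ 2 + p.2 ^ 2) / 2 = -p.1 ^ 2 / 2 + -p.2 ^ 2 / 2 by ring, Real.exp_add, ← h2]
  ring

theorem stmt11 (n m : ℕ) :
    (∫ p : ℝ × ℝ, Real.sqrt (p.1 ^ 2 + p.2 ^ 2) *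
        (Polynomial.aeval p.1 (Polynomial.hermite (2 * n)) : ℝ) *
        (Polynomial.aeval p.2 (Polynomial.hermite (2 * m)) : ℝ)
      ∂((ProbabilityTheory.gaussianReal 0 1).prod (ProbabilityTheory.gaussianReal 0 1))) =
    Real.sqrt (π / 2) *
      ((Nat.factorial (2 * n) : ℝ) * (Nat.factorial (2 * m)) /
        ((Nat.factorial n : ℝ) * (Nat.factorial m) * 2 ^ (n + m))) *
      ∑ j ∈ Finset.range (n + m + 1),
        (-1 : ℝ) ^ (n + m) * (-1 : ℝ) ^ j * ((n + m).choose j : ℝ) *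
          ((Nat.factorial (2 * j + 1) : ℝ) / ((Nat.factorial j : ℝ) ^ 2)) * (1 / 4) ^ j := by
  rw [gauss_int]
  let c : ℕ → ℕ → ℝ := fun n a => (-1) ^ n * (-1) ^ a * (Nat.factorial (2 * n) : ℝ) /
      (Nat.factorial n * 2 ^ n) * (n.choose a) *
      (2 ^ a * Nat.factorial a / Nat.factorial (2 * a))
  have e : ∀ p : ℝ × ℝ, √(p.1 ^ 2 + p.2 ^ 2) * (aeval p.1 (hermite (2 * n)) : ℝ) *
        (aeval p.2 (hermite (2 * m)) : ℝ) * rexp (-(p.1 ^ 2 + p.2 ^ 2) / 2) =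
      ∑ a ∈ Finset.range (n + 1), ∑ b ∈ Finset.range (m + 1), c n a * c m b *
        (√(p.1 ^ 2 + p.2 ^ 2) * (p.1 ^ (2 * a) * p.2 ^ (2 * b)) *
          rexp (-(p.1 ^ 2 + p.2 ^ 2) / 2)) := by
    intro p
    rw [hermite_even, hermite_even, mul_assoc (√_), Finset.sum_mul_sum, Finset.mul_sum,
      Finset.sum_mul]
    refine Finset.sum_congr rfl fun a _ => ?_
    rw [Finset.mul_sum, Finset.sum_mul]
    refine Finset.sum_congr rfl fun b _ => ?_
    simp only [c]
    ring
  simp_rw [e]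
  rw [integral_finsetSum _ fun a _ => integrable_finsetSum _ fun b _ =>
    (main_integrable a b).const_mul _]
  simp_rw [integral_finsetSum _ fun b _ => (main_integrable _ b).const_mul _, integral_const_mul,
    main_int]
  have hv := vander n m fun j => (-1) ^ j * ((Nat.factorial (2 * j + 1) : ℝ) /
    ((Nat.factorial j : ℝ) ^ 2)) * (1 / 4) ^ j
  have hs : ∑ j ∈ Finset.range (n + m + 1),
        (-1 : ℝ) ^ (n + m) * (-1 : ℝ) ^ j * ((n + m).choose j : ℝ) *
          ((Nat.factorial (2 * j + 1) : ℝ) / ((Nat.factorial j : ℝ) ^ 2)) * (1 / 4) ^ j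
      = (-1 : ℝ) ^ (n + m) * ∑ j ∈ Finset.range (n + m + 1), ((n + m).choose j : ℝ) *
        ((-1) ^ j * ((Nat.factorial (2 * j + 1) : ℝ) /
    ((Nat.factorial j : ℝ) ^ 2)) * (1 / 4) ^ j) := by
    rw [Finset.mul_sum]
    exact Finset.sum_congr rfl fun j _ => by ring
  rw [hs, ← hv]
  simp only [Finset.mul_sum]
  refine Finset.sum_congr rfl fun a _ => Finset.sum_congr rfl fun b _ => ?_
  simp only [c]
  generalize ((Nat.factorial (2 * (a + b) + 1) : ℝ) / ((Nat.factorial (a + b) : ℝ) ^ 2)) = Q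
  generalize (1 / 4 : ℝ) ^ (a + b) = R
  rw [pow_add, pow_add, pow_add]
  field_simp
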